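/- For every real number r ≥ e^{11}, (1 − (1/√(2π)) · (√(ln r)/(ln r + 1)) · r^{−1/2})^r ≤ 1/r². -/

import Mathlib

theorem exp_cubic_aux (L : ℝ) (hL : 11 ≤ L) :
    8 * Real.pi * L * (L + 1) ^ 2 ≤ Real.exp L := by
  obtain ⟨t, rfl⟩ : ∃ t, L = 11 + t := ⟨L - 11, by ring⟩
  have ht : 0 ≤ t := by linarith
  have h1 : (59000 : ℝ) ≤ Real.exp 11 := by
    have h : Real.exp 11 = Real.exp 1 ^ 11 := by
      rw [← Real.exp_nat_mul]; norm_num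
    rw [h]
    calc (59000 : ℝ) ≤ 2.718 ^ 11 := by norm_num
      _ ≤ Real.exp 1 ^ 11 := by
        gcongr
        linarith [Real.exp_one_gt_d9]
  have h2 : 1 + t + t ^ 2 / 2 + t ^ 3 / 6 ≤ Real.exp t := by
    have := Real.sum_le_exp_of_nonneg ht 4
    norm_num [Finset.sum_range_succ, Nat.factorial] at this
    linarith
  have hpi : 8 * Real.pi ≤ 26 := by linarith [Real.pi_lt_d2]
  rw [Real.exp_add]
  calc 8 * Real.pi * (11 + t) * (11 + t + 1) ^ 2
      ≤ 26 * (11 + t) * (11 + t + 1) ^ 2 := by gcongr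
    _ ≤ 59000 * (1 + t + t ^ 2 / 2 + t ^ 3 / 6) := by
        have := pow_nonneg ht 2
        have := pow_nonneg ht 3
        nlinarith
    _ ≤ Real.exp 11 * Real.exp t := by gcongr

/-- Numeric inequality: for every real `r ≥ e^{11}`,
`(1 − (1/√(2π)) · (√(ln r)/(ln r + 1)) · r^{−1/2})^r ≤ 1/r²`. -/
theorem gaussian_tail_numeric_bound (r : ℝ) (hr : Real.exp 11 ≤ r) :
    (1 - (1 / Real.sqrt (2 * Real.pi)) *
        (Real.sqrt (Real.log r) / (Real.log r + 1)) * r ^ (-(1:ℝ)/2)) ^ r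
      ≤ 1 / r^2 := by
  have hr0 : 0 < r := (Real.exp_pos 11).trans_le hr
  have hL : 11 ≤ Real.log r := (Real.le_log_iff_exp_le hr0).2 hr
  have hrL : r = Real.exp (Real.log r) := (Real.exp_log hr0).symm
  have haux := exp_cubic_aux _ hL
  have hpow : r ^ (-(1:ℝ)/2) = (Real.exp (Real.log r / 2))⁻¹ := by
    rw [Real.rpow_def_of_pos hr0, ← Real.exp_neg]
    congr 1; ring
  have hE2 : Real.exp (Real.log r / 2) ^ 2 = r := by
    rw [← Real.exp_nat_mul]
    conv_rhs => rw [hrL]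
    congr 1; push_cast; ring
  have hE1 : 1 ≤ Real.exp (Real.log r / 2) := Real.one_le_exp (by linarith)
  have hr2 : 1 / r ^ 2 = Real.exp (-(2 * Real.log r)) := by
    rw [Real.exp_neg, one_div]
    congr 1
    conv_lhs => rw [hrL]
    rw [← Real.exp_nat_mul]; norm_num
  rw [Real.exp_log hr0] at haux
  rw [hpow, hr2]
  have hs2 : Real.sqrt (Real.log r) ^ 2 = Real.log r := Real.sq_sqrt (by linarith)
  have hs0 : 0 ≤ Real.sqrt (Real.log r) := Real.sqrt_nonneg _
  have hq2 : Real.sqrt (2 * Real.pi) ^ 2 = 2 * Real.pi := Real.sq_sqrt (by positivity)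
  have hq1 : 1 ≤ Real.sqrt (2 * Real.pi) :=
    Real.one_le_sqrt.2 (by linarith [Real.pi_gt_three])
  clear hpow hr2 hrL hr
  generalize Real.exp (Real.log r / 2) = E at *
  generalize Real.sqrt (Real.log r) = s at *
  generalize Real.sqrt (2 * Real.pi) = q at *
  generalize Real.log r = L at *
  have hkey : 2 * q * s * (L + 1) ≤ E := by
    refine le_of_abs_le (abs_le_of_sq_le_sq ?_ (by linarith))
    calc (2 * q * s * (L + 1)) ^ 2 = 4 * q ^ 2 * s ^ 2 * (L + 1) ^ 2 := by ring
      _ = 8 * Real.pi * L * (L + 1) ^ 2 := by rw [hq2, hs2]; ring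
      _ ≤ E ^ 2 := by rw [hE2]; exact haux
  have hx : 1 / q * (s / (L + 1)) * E⁻¹ = s / (q * (L + 1) * E) := by
    field_simp
  have hD : 0 < q * (L + 1) * E := by positivity
  rw [hx]
  have hx1 : s / (q * (L + 1) * E) ≤ 1 := by
    rw [div_le_one hD]
    have h1 : s ≤ L + 1 := by nlinarith
    calc s ≤ 1 * (L + 1) * 1 := by linarith
      _ ≤ q * (L + 1) * E := by gcongr
  have hxr : 2 * L ≤ s / (q * (L + 1) * E) * r := by
    rw [← hE2, div_mul_eq_mul_div, le_div_iff₀ hD, ← hs2]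
    rw [← hs2] at hkey
    have := mul_le_mul_of_nonneg_left hkey (mul_nonneg hs0 (by linarith : (0:ℝ) ≤ E))
    nlinarith
  calc (1 - s / (q * (L + 1) * E)) ^ r
      ≤ (Real.exp (-(s / (q * (L + 1) * E)))) ^ r := by
        refine Real.rpow_le_rpow (by linarith) (Real.one_sub_le_exp_neg _) hr0.le
    _ = Real.exp (-(s / (q * (L + 1) * E) * r)) := by
        rw [← Real.exp_mul]; congr 1; ring
    _ ≤ Real.exp (-(2 * L)) := Real.exp_le_exp.2 (by linarith)
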